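/- In the Setting, assume that λ > μ(𝔞) − 1 (μ(𝔞) being the minimal number of generators of 𝔞) and that (q − 1)λ is an integer. If the equality τ_{n−1}(X/V, φ I, 𝔞^λ) B_n = τ_n(X/V, φ I, 𝔞^λ) holds for some integer n ≥ 1, then the equality τ_{m−1}(X/V, φ I, 𝔞^λ) B_m = τ_m(X/V, φ I, 𝔞^λ) holds for every integer m > n. -/

import Mathlib

/-!
This file formalizes a statement about the limiting relative test ideals of
Sato–Takagi, "General hyperplane sections of log canonical threefolds /
Deformations of F-pure and F-regular singularities" (Appendix A).

Throughout, for a (commutative) ring `C` of characteristic `p > 0` and `q = p^e`,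
the ring `C^{1/q^n}` of `q^n`-th roots is *modelled* by a copy of `C`, the
identification being the isomorphism `ψ_n : C^{1/q^n} ≃ C`, `x ↦ x^{q^n}`.
Under this identification:
* the inclusion `C ⊆ C^{1/q^n}` becomes `x ↦ x^{q^n}`,
* the inclusion `C^{1/q^i} ⊆ C^{1/q^n}` (`i ≤ n`) becomes `x ↦ x^{q^{n-i}}`,
* for a `C`-module `M`, the `C^{1/q^n}`-module `M^{1/q^n}` becomes the
  abelian group `M` with appropriately twisted scalar multiplications.
All objects of the Setting (`B_n = R ⊗_A A^{1/q^n}`, `L^{(n)}`, the maps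
`φ̃_n`, `φ^n`, the ideals `τ_n(X/V, φ I, 𝔞^λ)`) are realized accordingly below.
-/

open scoped TensorProduct

noncomputable section

universe u

/-- `A^{1/q^n}`, realized as a copy of `A`; the identification sends `x ∈ A^{1/q^n}`
to its coordinate `x^{q^n} ∈ A`. -/
def ARoot (A : Type u) (p e n : ℕ) : Type u := A

namespace ARoot

variable (A : Type u) [CommRing A] (p e : ℕ) [ExpChar A p]

instance (n : ℕ) : CommRing (ARoot A p e n) := inferInstanceAs (CommRing A)

/-- the inclusion `A ⊆ A^{1/q^n}` (in coordinates, `a ↦ a^{q^n}`). -/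
instance (n : ℕ) : Algebra A (ARoot A p e n) :=
  (show A →+* ARoot A p e n from iterateFrobenius A p (e * n)).toAlgebra

/-- coordinate-wise identity map `A^{1/q^m} → A^{1/q^n}`; for `m ≤ n` this is the
`q^{n-m}`-th root isomorphism `x ↦ x^{1/q^{n-m}}`. -/
def cast {A : Type u} {p e : ℕ} (m n : ℕ) (a : ARoot A p e m) : ARoot A p e n := a

/-- the inclusion `A^{1/q^i} ⊆ A^{1/q^n}` for `i ≤ n` (in coordinates,
`x ↦ x^{q^{n-i}}`). -/
def incl (i n : ℕ) (h : i ≤ n) : ARoot A p e i →ₐ[A] ARoot A p e n :=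
  AlgHom.mk (show ARoot A p e i →+* ARoot A p e n from iterateFrobenius A p (e * (n - i)))
    (fun a => by
      show iterateFrobenius A p (e * (n - i)) (iterateFrobenius A p (e * i) a)
        = iterateFrobenius A p (e * n) a
      rw [iterateFrobenius_def, iterateFrobenius_def, iterateFrobenius_def,
        ← pow_mul, ← pow_add, ← Nat.mul_add, Nat.add_sub_cancel' h])

end ARoot

section B

variable (A : Type u) [CommRing A] (p e : ℕ) [ExpChar A p]
variable (R : Type u) [CommRing R] [Algebra A R] [ExpChar R p]

/-- `B_n := R ⊗_A A^{1/q^n}`. -/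
def BRing (n : ℕ) : Type u := R ⊗[A] (ARoot A p e n)

instance (n : ℕ) : CommRing (BRing A p e R n) :=
  inferInstanceAs (CommRing (R ⊗[A] ARoot A p e n))

instance (n : ℕ) : Algebra A (BRing A p e R n) :=
  inferInstanceAs (Algebra A (R ⊗[A] ARoot A p e n))

instance (n : ℕ) : Algebra R (BRing A p e R n) :=
  inferInstanceAs (Algebra R (R ⊗[A] ARoot A p e n))

/-- the natural map `a_{i,n} : B_i → B_n` (`i ≤ n`) induced by
`A^{1/q^i} ⊆ A^{1/q^n}`. -/
def aMap (i n : ℕ) (h : i ≤ n) : BRing A p e R i →ₐ[A] BRing A p e R n :=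
  Algebra.TensorProduct.map (AlgHom.id A R) (ARoot.incl A p e i n h)

/-- A copy of `R` with the `A`-algebra structure `a ↦ (algebraMap A R a)^{q^n}`;
an auxiliary device used to define `Θ_n : B_n → R` below. -/
def Rtw (A : Type u) (p e : ℕ) (R : Type u) (n : ℕ) : Type u := R

instance (n : ℕ) : CommRing (Rtw A p e R n) := inferInstanceAs (CommRing R)

instance (n : ℕ) : Algebra A (Rtw A p e R n) :=
  ((show R →+* Rtw A p e R n from iterateFrobenius R p (e * n)).comp (algebraMap A R)).toAlgebra

/-- `Θ_n : B_n = R ⊗_A A^{1/q^n} →+* R` is the ring homomorphism corresponding, under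
the identifications above, to the inclusion `B_n ⊆ R^{1/q^n}` followed by the
isomorphism `R^{1/q^n} ≅ R`, `x ↦ x^{q^n}`; concretely, on coordinates,
`Θ_n (r ⊗ a) = r^{q^n} · g(a)` where `g : A → R` is the structure map.
Restriction of scalars along `Θ_n` equips the underlying group `M` of an
`R`-module with its `B_n`-module structure of `M^{1/q^n}`. -/
def theta (n : ℕ) : BRing A p e R n →+* R :=
  show BRing A p e R n →+* Rtw A p e R n from
  (Algebra.TensorProduct.productMap
    (AlgHom.mk (show R →+* Rtw A p e R n from iterateFrobenius R p (e * n)) (fun a => by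
      show iterateFrobenius R p (e * n) (algebraMap A R a) = algebraMap A (Rtw A p e R n) a
      rw [RingHom.algebraMap_toAlgebra]; rfl))
    (AlgHom.mk (show ARoot A p e n →+* Rtw A p e R n from algebraMap A R) (fun a => by
      show algebraMap A R (iterateFrobenius A p (e * n) a)
          = iterateFrobenius R p (e * n) (algebraMap A R a)
      rw [iterateFrobenius_def, iterateFrobenius_def, map_pow]))).toRingHom

/-- `M^{1/q^n}` for an `R`-module `M`: the abelian group `M` viewed as a module
over `B_n` via `Θ_n`. -/
def RootMod (A : Type u) (p e : ℕ) (R : Type u) (n : ℕ) (M : Type u) : Type u := M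

instance (n : ℕ) (M : Type u) [AddCommGroup M] : AddCommGroup (RootMod A p e R n M) :=
  inferInstanceAs (AddCommGroup M)

instance (n : ℕ) (M : Type u) [AddCommGroup M] [Module R M] :
    Module (BRing A p e R n) (RootMod A p e R n M) :=
  Module.compHom M (theta A p e R n)

/-- the tautological map `M → M^{1/q^n}`, `x ↦ x^{1/q^n}`. -/
def RootMod.of (n : ℕ) {M : Type u} (x : M) : RootMod A p e R n M := x

variable (L : Type u) [AddCommGroup L] [Module R L]

/-- `L^{(n)} := L^{⊗ (q^n - 1)/(q - 1)}`, realized recursively via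
`L^{(0)} = R` and `L^{(n+1)} = L^{⊗ q^n} ⊗_R L^{(n)}`. -/
def LObj (q : ℕ) : ℕ → ModuleCat.{u} R
  | 0 => ModuleCat.of R R
  | (n+1) => ModuleCat.of R (TensorPower R (q ^ n) L ⊗[R] (LObj q n))

/-- The `n`-th limiting relative test ideal
`τ_n(X/V, φ I, 𝔞^λ) := Σ_{i=0}^n φ^i((𝔞^{⌈q^i λ⌉} I L^{(i)})^{1/q^i}) B_n ⊆ B_n`,
expressed in terms of the family `Φ = (φ^i)_i` of the maps
`φ^i : (L^{(i)})^{1/q^i} → B_i`. -/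
def tauRel
    (Φ : (n : ℕ) → (RootMod A p e R n (LObj R L (p ^ e) n)
      →ₗ[BRing A p e R n] BRing A p e R n))
    (I 𝔞 : Ideal R) (lam : ℝ) (n : ℕ) : Ideal (BRing A p e R n) :=
  ⨆ i : Fin (n + 1),
    Ideal.span ((aMap A p e R i n (Nat.lt_succ_iff.mp i.isLt)) ''
      ((fun x : LObj R L (p ^ e) i => Φ i (RootMod.of A p e R i x)) ''
        (((𝔞 ^ ⌈((p : ℝ) ^ e) ^ (i : ℕ) * lam⌉₊ * I) •
            (⊤ : Submodule R (LObj R L (p ^ e) i)) :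
              Submodule R (LObj R L (p ^ e) i)) :
          Set (LObj R L (p ^ e) i))))

end B


namespace Ideal

open scoped Pointwise in
/-- If `𝔞` is generated by `μ` elements, a power `𝔞 ^ (N + Q)` with `N ≥ (μ - 1) * Q` lies in
`𝔞 ^ N` times the ideal generated by the `Q`-th powers. -/
theorem span_pow_add_le_mul_span_image_pow {R : Type*} [CommRing R] {s : Finset R}
    (hs : s.Nonempty) {N Q : ℕ} (hQ : 0 < Q) (hN : s.card * Q ≤ N + Q) :
    span (s : Set R) ^ (N + Q) ≤
      span (s : Set R) ^ N * span ((fun x => x ^ Q) '' (s : Set R)) := by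
  classical
  have hpow : span (s : Set R) ^ (N + Q) = span ((s : Set R) ^ (N + Q)) :=
    Submodule.span_pow _ _
  rw [hpow, span_le]
  intro a ha
  obtain ⟨f, rfl⟩ := Set.mem_pow.mp ha
  obtain ⟨y, hy⟩ : ∃ y : (s : Set R), Q - 1 < (Finset.univ.filter fun i => f i = y).card := by
    apply Fintype.exists_lt_card_fiber_of_mul_lt_card
    have h1 : Fintype.card (s : Set R) = s.card := by simp
    rw [h1, Fintype.card_fin]
    have := hs.card_pos
    calc s.card * (Q - 1) < s.card * Q := Nat.mul_lt_mul_of_pos_left (by omega) this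
      _ ≤ _ := hN
  obtain ⟨t, ht, htc⟩ := Finset.exists_subset_card_eq
    (s := Finset.univ.filter fun i => f i = y) (n := Q) (by omega)
  rw [List.prod_ofFn, ← Finset.prod_mul_prod_compl t, mul_comm (span _ ^ N)]
  apply Ideal.mul_mem_mul
  · have hprod : ∏ i ∈ t, (f i : R) = (y : R) ^ t.card :=
      Finset.prod_eq_pow_card fun i hi => by rw [(Finset.mem_filter.mp (ht hi)).2]
    rw [hprod, htc]
    exact subset_span ⟨y, y.2, rfl⟩
  · have hmem := Ideal.prod_mem_prod (s := tᶜ) (I := fun _ => span (s : Set R))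
      (x := fun i => (f i : R)) fun i _ => subset_span (f i).2
    rwa [Finset.prod_const, Finset.card_compl, htc, Fintype.card_fin,
      Nat.add_sub_cancel] at hmem

theorem span_pow_add_mul_le_mul_map_iterateFrobenius {R : Type*} [CommRing R] (p : ℕ)
    [ExpChar R p] {s : Finset R} (hs : s.Nonempty) {N f : ℕ}
    (hN : s.card * p ^ f ≤ N + p ^ f) (k : ℕ) :
    span (s : Set R) ^ (N + p ^ f * k) ≤
      span (s : Set R) ^ N * map (iterateFrobenius R p f) (span (s : Set R) ^ k) := by
  have hmap : map (iterateFrobenius R p f) (span (s : Set R)) =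
      span ((fun x => x ^ p ^ f) '' (s : Set R)) := by
    rw [map_span]; rfl
  rw [Ideal.map_pow, hmap]
  induction k with
  | zero => simp
  | succ k ih =>
    have := span_pow_add_le_mul_span_image_pow hs (N := N + p ^ f * k)
      (expChar_pow_pos R p f) (by omega)
    rw [Nat.mul_succ, ← add_assoc, pow_succ, ← mul_assoc]
    exact this.trans (mul_mono_left ih)

end Ideal

namespace Module.Invertible

theorem dual_smul_comm {R M : Type*} [CommRing R] [AddCommGroup M] [Module R M]
    [Module.Invertible R M] (f : Module.Dual R M) (x y : M) : f x • y = f y • x := by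
  simpa using congrArg (fun t => TensorProduct.lid R M (f.rTensor M t))
    (tmul_comm (R := R) (m₁ := x) (m₂ := y))

/-- The tensor powers of an invertible module are spanned by the pure powers. -/
theorem span_tprod_const_eq_top (R M : Type*) [CommRing R] [AddCommGroup M] [Module R M]
    [Module.Invertible R M] (N : ℕ) :
    Submodule.span R
      (Set.range fun m : M => PiTensorProduct.tprod R fun _ : Fin N => m) = ⊤ := by
  have htop : Ideal.span {r : R | ∃ (f : Module.Dual R M) (m : M), f m = r} = ⊤ := by
    rw [Ideal.eq_top_iff_one]
    obtain ⟨t, ht⟩ := (bijective (R := R) (M := M)).surjective 1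
    rw [← ht]
    clear ht
    induction t with
    | zero => simp
    | tmul f m => exact Ideal.subset_span ⟨f, m, by simp⟩
    | add x y hx hy => rw [map_add]; exact add_mem hx hy
  rw [← top_le_iff, ← PiTensorProduct.span_tprod_eq_top, Submodule.span_le]
  rintro _ ⟨y, rfl⟩
  have key : ∀ c ∈ Ideal.span ((fun r => r ^ N) ''
      {r : R | ∃ (f : Module.Dual R M) (m : M), f m = r}),
      c • PiTensorProduct.tprod R y ∈ Submodule.span R
        (Set.range fun m : M => PiTensorProduct.tprod R fun _ : Fin N => m) := by
    intro c hc
    induction hc using Submodule.span_induction with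
    | zero => simp
    | add a b _ _ ha hb => rw [add_smul]; exact add_mem ha hb
    | smul a b _ hb => rw [smul_assoc]; exact Submodule.smul_mem _ _ hb
    | mem c hc =>
      obtain ⟨_, ⟨f, m, rfl⟩, rfl⟩ := hc
      have : (f m) ^ N • PiTensorProduct.tprod R y =
          (∏ i, f (y i)) • PiTensorProduct.tprod R fun _ : Fin N => m := by
        rw [← MultilinearMap.map_smul_univ]
        have h : (f m) ^ N = ∏ _i : Fin N, f m := by simp
        rw [h, ← MultilinearMap.map_smul_univ]
        congr 1
        ext i
        exact dual_smul_comm f m (y i)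
      simp only [this]
      exact Submodule.smul_mem _ _ (Submodule.subset_span ⟨m, rfl⟩)
  simpa using key 1 (by rw [Ideal.span_pow_eq_top _ htop]; trivial)

/-- Induction principle for `J • (M^{⊗ N} ⊗ W)` with `M` invertible. -/
theorem smul_tensorPower_tensor_induction {R M W : Type*} [CommRing R] [AddCommGroup M]
    [Module R M] [Module.Invertible R M] [AddCommGroup W] [Module R W] (N : ℕ) (J : Ideal R)
    {P : TensorPower R N M ⊗[R] W → Prop}
    (tmul : ∀ (m : M) (w : W), ∀ c ∈ J, P ((PiTensorProduct.tprod R fun _ => m) ⊗ₜ (c • w)))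
    (zero : P 0)
    (add : ∀ x y, P x → P y → P (x + y)) {x : TensorPower R N M ⊗[R] W}
    (hx : x ∈ J • (⊤ : Submodule R (TensorPower R N M ⊗[R] W))) : P x := by
  refine Submodule.smul_induction_on hx (fun c hc x hx => ?_) add
  clear hx
  induction x with
  | zero => simpa
  | add x y hx hy => rw [smul_add]; exact add _ _ hx hy
  | tmul t w =>
    have ht : t ∈ Submodule.span R
      (Set.range fun m : M => PiTensorProduct.tprod R fun _ : Fin N => m) := by
        rw [span_tprod_const_eq_top]; trivial
    induction ht using Submodule.span_induction generalizing c w with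
    | zero => simpa
    | add x y _ _ hx hy =>
      rw [TensorProduct.add_tmul, smul_add]
      exact add _ _ (hx c hc w) (hy c hc w)
    | smul a x _ h =>
      rw [TensorProduct.smul_tmul]
      exact h c hc (a • w)
    | mem x h =>
      obtain ⟨m, rfl⟩ := h
      rw [← TensorProduct.tmul_smul]
      exact tmul m w c hc

end Module.Invertible

section Auxiliary

variable {A : Type u} [CommRing A] {p e : ℕ} [ExpChar A p]
variable {R : Type u} [CommRing R] [Algebra A R]
variable {L : Type u} [AddCommGroup L] [Module R L]

theorem ARoot.incl_incl {i j n : ℕ} (h : i ≤ j) (h' : j ≤ n) (a : ARoot A p e i) :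
    ARoot.incl A p e j n h' (ARoot.incl A p e i j h a) =
      ARoot.incl A p e i n (h.trans h') a := by
  have key (x : A) : iterateFrobenius A p (e * (n - j)) (iterateFrobenius A p (e * (j - i)) x) =
      iterateFrobenius A p (e * (n - i)) x := by
    rw [iterateFrobenius_def, iterateFrobenius_def, iterateFrobenius_def, ← pow_mul, ← pow_add,
      ← Nat.mul_add, show j - i + (n - j) = n - i by omega]
  exact key a

theorem ARoot.incl_self (n : ℕ) (a : ARoot A p e n) : ARoot.incl A p e n n le_rfl a = a := by
  have key (x : A) : iterateFrobenius A p (e * (n - n)) x = x := by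
    rw [iterateFrobenius_def, Nat.sub_self, mul_zero, pow_zero, pow_one]
  exact key a

theorem ARoot.incl_cast (n : ℕ) (a : ARoot A p e n) :
    ARoot.incl A p e (n + 1) (n + 2) (n + 1).le_succ (ARoot.cast n (n + 1) a) =
      ARoot.cast (n + 1) (n + 2) (ARoot.incl A p e n (n + 1) n.le_succ a) := by
  have key (x : A) : iterateFrobenius A p (e * (n + 2 - (n + 1))) x =
      iterateFrobenius A p (e * (n + 1 - n)) x := by
    rw [show n + 2 - (n + 1) = n + 1 - n by omega]
  exact key a

namespace BRing

/-- The pure tensors of `B_n = R ⊗_A A^{1/q^n}`. -/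
def tmul {n : ℕ} (r : R) (a : ARoot A p e n) : BRing A p e R n := r ⊗ₜ[A] a

@[elab_as_elim]
theorem induction {n : ℕ} {P : BRing A p e R n → Prop} (b : BRing A p e R n) (zero : P 0)
    (tmul : ∀ r a, P (tmul r a)) (add : ∀ x y, P x → P y → P (x + y)) : P b :=
  TensorProduct.induction_on b zero tmul add

theorem tmul_mul_tmul {n : ℕ} (r r' : R) (a a' : ARoot A p e n) :
    (tmul r a * tmul r' a' : BRing A p e R n) = tmul (r * r') (a * a') :=
  Algebra.TensorProduct.tmul_mul_tmul r r' a a'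

theorem smul_tmul {n : ℕ} (r r' : R) (a : ARoot A p e n) :
    (r • tmul r' a : BRing A p e R n) = tmul (r * r') a :=
  TensorProduct.smul_tmul' r r' a

theorem aMap_tmul {i n : ℕ} (h : i ≤ n) (r : R) (a : ARoot A p e i) :
    aMap A p e R i n h (tmul r a) = tmul r (ARoot.incl A p e i n h a) := rfl

theorem aMap_aMap {i j n : ℕ} (h : i ≤ j) (h' : j ≤ n) (b : BRing A p e R i) :
    aMap A p e R j n h' (aMap A p e R i j h b) = aMap A p e R i n (h.trans h') b := by
  induction b using BRing.induction with
  | zero => simp only [map_zero]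
  | tmul r a => rw [aMap_tmul, aMap_tmul, aMap_tmul, ARoot.incl_incl]
  | add x y hx hy => simp only [map_add, hx, hy]

theorem aMap_self (n : ℕ) (b : BRing A p e R n) : aMap A p e R n n le_rfl b = b := by
  induction b using BRing.induction with
  | zero => simp only [map_zero]
  | tmul r a => rw [aMap_tmul, ARoot.incl_self]
  | add x y hx hy => simp only [map_add, hx, hy]

theorem map_aMap_map_aMap {i j n : ℕ} (h : i ≤ j) (h' : j ≤ n) (J : Ideal (BRing A p e R i)) :
    (J.map (aMap A p e R i j h)).map (aMap A p e R j n h') =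
      J.map (aMap A p e R i n (h.trans h')) := by
  have : (aMap A p e R j n h').comp (aMap A p e R i j h) = aMap A p e R i n (h.trans h') :=
    AlgHom.ext (aMap_aMap h h')
  rw [← this, Ideal.map_mapₐ]

theorem map_aMap_self (n : ℕ) (J : Ideal (BRing A p e R n)) :
    J.map (aMap A p e R n n le_rfl) = J := by
  have : aMap A p e R n n le_rfl = AlgHom.id A _ := AlgHom.ext (aMap_self n)
  rw [this]
  exact Ideal.map_id J

theorem map_algebraMap_aMap {i n : ℕ} (h : i ≤ n) (𝔠 : Ideal R) :
    (𝔠.map (algebraMap R (BRing A p e R i))).map (aMap A p e R i n h) =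
      𝔠.map (algebraMap R (BRing A p e R n)) := by
  have hcomp : (aMap A p e R i n h : BRing A p e R i →+* BRing A p e R n).comp
      (algebraMap R (BRing A p e R i)) = algebraMap R (BRing A p e R n) :=
    RingHom.ext fun r => congrArg (BRing.tmul r) (map_one (ARoot.incl A p e i n h))
  rw [← hcomp, ← Ideal.map_map]
  rfl

end BRing

section Shift

variable (Φt : (n : ℕ) → (L ⊗[R] BRing A p e R n) →+ BRing A p e R (n + 1))

/-- The ideal `φ̃_{n+1}((L ⊗ J)^{1/q})` of `B_{n+1}`, for an ideal `J` of `B_n`. -/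
def shiftIdeal (n : ℕ) (J : Ideal (BRing A p e R n)) : Ideal (BRing A p e R (n + 1)) :=
  Ideal.span {b | ∃ (l : L), ∃ j ∈ J, Φt n (l ⊗ₜ[R] j) = b}

variable {Φt}

theorem mem_shiftIdeal {n : ℕ} {J : Ideal (BRing A p e R n)} (l : L) {j : BRing A p e R n}
    (hj : j ∈ J) : Φt n (l ⊗ₜ[R] j) ∈ shiftIdeal Φt n J :=
  Ideal.subset_span ⟨l, j, hj, rfl⟩

theorem shiftIdeal_sup_le (n : ℕ) (J J' : Ideal (BRing A p e R n)) :
    shiftIdeal Φt n (J ⊔ J') ≤ shiftIdeal Φt n J ⊔ shiftIdeal Φt n J' := by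
  rw [shiftIdeal, Ideal.span_le]
  rintro _ ⟨l, x, hx, rfl⟩
  obtain ⟨j, hj, j', hj', rfl⟩ := Submodule.mem_sup.mp hx
  rw [TensorProduct.tmul_add, map_add]
  exact add_mem (Ideal.mem_sup_left (mem_shiftIdeal l hj))
    (Ideal.mem_sup_right (mem_shiftIdeal l hj'))

theorem shiftIdeal_mono (n : ℕ) {J J' : Ideal (BRing A p e R n)} (h : J ≤ J') :
    shiftIdeal Φt n J ≤ shiftIdeal Φt n J' :=
  Ideal.span_mono fun _ ⟨l, j, hj, hb⟩ => ⟨l, j, h hj, hb⟩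

end Shift

variable [ExpChar R p]

theorem theta_algebraMap (n : ℕ) (r : R) :
    theta A p e R n (algebraMap R (BRing A p e R n) r) = iterateFrobenius R p (e * n) r := by
  change (iterateFrobenius R p (e * n) r) * algebraMap A R 1 = _
  rw [map_one, mul_one]

section Image

variable (Φ : (n : ℕ) → (RootMod A p e R n (LObj R L (p ^ e) n)
      →ₗ[BRing A p e R n] BRing A p e R n))

/-- The ideal `φ^n((J L^{(n)})^{1/q^n})` of `B_n`. -/
def rootImage (n : ℕ) (J : Ideal R) : Ideal (BRing A p e R n) :=
  Ideal.span ((fun x : LObj R L (p ^ e) n => Φ n (RootMod.of A p e R n x)) ''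
    ((J • (⊤ : Submodule R (LObj R L (p ^ e) n)) : Submodule R (LObj R L (p ^ e) n)) :
      Set (LObj R L (p ^ e) n)))

variable {Φ}

theorem map_theta_smul (n : ℕ) (b : BRing A p e R n) (x : LObj R L (p ^ e) n) :
    Φ n (RootMod.of A p e R n (theta A p e R n b • x)) =
      b * Φ n (RootMod.of A p e R n x) :=
  (Φ n).map_smul b (RootMod.of A p e R n x)

theorem map_iterateFrobenius_smul (n : ℕ) (c : R) (x : LObj R L (p ^ e) n) :
    Φ n (RootMod.of A p e R n (iterateFrobenius R p (e * n) c • x)) =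
      algebraMap R (BRing A p e R n) c * Φ n (RootMod.of A p e R n x) := by
  rw [← theta_algebraMap (A := A), map_theta_smul]

theorem mem_rootImage {n : ℕ} {J : Ideal R} {b : BRing A p e R n} :
    b ∈ rootImage Φ n J ↔
      ∃ x ∈ J • (⊤ : Submodule R (LObj R L (p ^ e) n)), Φ n (RootMod.of A p e R n x) = b := by
  refine ⟨fun hb => ?_, fun ⟨x, hx, hb⟩ => Ideal.subset_span ⟨x, hx, hb⟩⟩
  induction hb using Submodule.span_induction with
  | mem b hb => exact hb
  | zero => exact ⟨0, zero_mem _, (Φ n).map_zero⟩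
  | add b c _ _ hb hc =>
    obtain ⟨x, hx, rfl⟩ := hb
    obtain ⟨y, hy, rfl⟩ := hc
    exact ⟨x + y, add_mem hx hy, (Φ n).map_add _ _⟩
  | smul a b _ hb =>
    obtain ⟨x, hx, rfl⟩ := hb
    exact ⟨theta A p e R n a • x, Submodule.smul_mem _ _ hx, map_theta_smul n a x⟩

theorem map_mul_rootImage (n : ℕ) (J 𝔠 : Ideal R) :
    𝔠.map (algebraMap R (BRing A p e R n)) * rootImage Φ n J =
      rootImage Φ n (𝔠.map (iterateFrobenius R p (e * n)) * J) := by
  apply le_antisymm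
  · rw [Ideal.map, rootImage, Ideal.span_mul_span', Ideal.span_le]
    rintro _ ⟨_, ⟨c, hc, rfl⟩, _, ⟨x, hx, rfl⟩, rfl⟩
    refine mem_rootImage.mpr
      ⟨iterateFrobenius R p (e * n) c • x, ?_, map_iterateFrobenius_smul n c x⟩
    rw [Submodule.mul_smul]
    exact Submodule.smul_mem_smul (Ideal.mem_map_of_mem _ hc) hx
  · intro b hb
    obtain ⟨x, hx, rfl⟩ := mem_rootImage.mp hb
    clear hb
    rw [Submodule.mul_smul] at hx
    refine Submodule.smul_induction_on hx (fun f hf x hx => ?_) (fun x y hx hy =>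
      ((Φ n).map_add (RootMod.of A p e R n x) (RootMod.of A p e R n y)).symm ▸ add_mem hx hy)
    induction hf using Submodule.span_induction generalizing x with
    | mem f hf =>
      obtain ⟨c, hc, rfl⟩ := hf
      exact (map_iterateFrobenius_smul (Φ := Φ) n c x).symm ▸
        Ideal.mul_mem_mul (Ideal.mem_map_of_mem _ hc) (mem_rootImage.mpr ⟨x, hx, rfl⟩)
    | zero =>
      rw [zero_smul]
      exact (Φ n).map_zero.symm ▸ zero_mem _
    | add f g _ _ hf hg =>
      rw [add_smul]
      exact ((Φ n).map_add (RootMod.of A p e R n (f • x)) (RootMod.of A p e R n (g • x))).symm ▸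
        add_mem (hf x hx) (hg x hx)
    | smul a f _ hf =>
      rw [smul_eq_mul, mul_comm a f, mul_smul]
      exact hf _ (Submodule.smul_mem _ a hx)

variable {Φt : (n : ℕ) → (L ⊗[R] BRing A p e R n) →+ BRing A p e R (n + 1)}

theorem rootImage_succ [Module.Invertible R L]
    (hΦsucc : ∀ (n : ℕ) (l : L) (w : LObj R L (p ^ e) n),
      Φ (n+1) (RootMod.of A p e R (n+1)
          ((PiTensorProduct.tprod R fun _ : Fin ((p ^ e) ^ n) => l) ⊗ₜ[R] w))
        = Φt n (l ⊗ₜ[R] (Φ n (RootMod.of A p e R n w)))) (n : ℕ) (J : Ideal R) :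
    rootImage Φ (n + 1) J = shiftIdeal Φt n (rootImage Φ n J) := by
  apply le_antisymm
  · intro b hb
    obtain ⟨x, hx, rfl⟩ := mem_rootImage.mp hb
    refine Module.Invertible.smul_tensorPower_tensor_induction (R := R) (M := L)
      (W := LObj R L (p ^ e) n) ((p ^ e) ^ n) J
      (P := fun x => Φ (n + 1) (RootMod.of A p e R (n + 1) x) ∈ shiftIdeal Φt n (rootImage Φ n J))
      (fun l w c hc => ?_) ?_ (fun x y hx hy => ?_) hx
    · rw [hΦsucc]
      exact mem_shiftIdeal l (mem_rootImage.mpr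
        ⟨_, Submodule.smul_mem_smul hc Submodule.mem_top, rfl⟩)
    · exact (Φ (n + 1)).map_zero.symm ▸ zero_mem _
    · exact ((Φ (n + 1)).map_add (RootMod.of A p e R (n + 1) x)
        (RootMod.of A p e R (n + 1) y)).symm ▸ add_mem hx hy
  · rw [shiftIdeal, Ideal.span_le]
    rintro _ ⟨l, j, hj, rfl⟩
    obtain ⟨w, hw, rfl⟩ := mem_rootImage.mp hj
    rw [← hΦsucc]
    refine mem_rootImage.mpr ⟨_, ?_, rfl⟩
    have : J • (⊤ : Submodule R (LObj R L (p ^ e) n)) ≤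
        (J • (⊤ : Submodule R (TensorPower R ((p ^ e) ^ n) L ⊗[R] LObj R L (p ^ e) n))).comap
          (TensorProduct.mk R _ _ (PiTensorProduct.tprod R fun _ => l)) :=
      Submodule.smul_le.mpr fun c hc w _ => by
        rw [Submodule.mem_comap, map_smul]
        exact Submodule.smul_mem_smul hc Submodule.mem_top
    exact this hw

end Image

section BaseChange

variable {Φt : (n : ℕ) → (L ⊗[R] BRing A p e R n) →+ BRing A p e R (n + 1)}
variable {φ : RootMod A p e R 1 L →ₗ[BRing A p e R 1] BRing A p e R 1}

variable (φ Φt) in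
/-- The maps `φ̃_{n+1} = Φt n` are the base changes of `φ`. -/
def IsBaseChangeFamily : Prop :=
  ∀ (n : ℕ) (l : L) (r : R) (a : ARoot A p e n),
    Φt n (l ⊗ₜ[R] BRing.tmul r a) =
      aMap A p e R 1 (n + 1) (Nat.le_add_left 1 n) (φ (RootMod.of A p e R 1 (r • l))) *
        BRing.tmul 1 (ARoot.cast n (n + 1) a)

namespace IsBaseChangeFamily

theorem tmul_aMap (h : IsBaseChangeFamily Φt φ) (n : ℕ) (l : L) (b : BRing A p e R n) :
    Φt (n + 1) (l ⊗ₜ[R] aMap A p e R n (n + 1) n.le_succ b) =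
      aMap A p e R (n + 1) (n + 2) (n + 1).le_succ (Φt n (l ⊗ₜ[R] b)) := by
  induction b using BRing.induction with
  | zero => simp only [map_zero, TensorProduct.tmul_zero]
  | tmul r a =>
    rw [BRing.aMap_tmul, h, h, map_mul, BRing.aMap_aMap, BRing.aMap_tmul, ARoot.incl_cast]
  | add x y hx hy => simp only [map_add, TensorProduct.tmul_add, hx, hy]

theorem tmul_mul (h : IsBaseChangeFamily Φt φ) (n : ℕ) (l : L) (a : ARoot A p e n)
    (b : BRing A p e R n) :
    Φt n (l ⊗ₜ[R] (BRing.tmul 1 a * b)) =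
      BRing.tmul 1 (ARoot.cast n (n + 1) a) * Φt n (l ⊗ₜ[R] b) := by
  induction b using BRing.induction with
  | zero => simp only [map_zero, TensorProduct.tmul_zero, mul_zero]
  | tmul r a' =>
    have hcast : BRing.tmul (A := A) (p := p) (e := e) (1 : R) (ARoot.cast n (n + 1) (a * a')) =
        BRing.tmul 1 (ARoot.cast n (n + 1) a) * BRing.tmul 1 (ARoot.cast n (n + 1) a') := by
      rw [BRing.tmul_mul_tmul, one_mul]
      rfl
    rw [BRing.tmul_mul_tmul, h, h, one_mul, hcast]
    ring
  | add x y hx hy => simp only [mul_add, map_add, TensorProduct.tmul_add, hx, hy]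

theorem shiftIdeal_map_le (h : IsBaseChangeFamily Φt φ) (n : ℕ) (J : Ideal (BRing A p e R n)) :
    shiftIdeal Φt (n + 1) (J.map (aMap A p e R n (n + 1) n.le_succ)) ≤
      (shiftIdeal Φt n J).map (aMap A p e R (n + 1) (n + 2) (n + 1).le_succ) := by
  rw [shiftIdeal, Ideal.span_le]
  rintro _ ⟨l, x, hx, rfl⟩
  induction hx using Submodule.span_induction generalizing l with
  | zero => rw [TensorProduct.tmul_zero, map_zero]; exact zero_mem _
  | add x y _ _ hx hy =>
    rw [TensorProduct.tmul_add, map_add]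
    exact add_mem (hx l) (hy l)
  | mem x hx =>
    obtain ⟨j, hj, rfl⟩ := hx
    exact (h.tmul_aMap n l j).symm ▸ Ideal.mem_map_of_mem _ (mem_shiftIdeal l hj)
  | smul b x _ hx =>
    induction b using BRing.induction with
    | zero => rw [zero_smul, TensorProduct.tmul_zero, map_zero]; exact zero_mem _
    | tmul r a =>
      rw [← mul_one r, ← BRing.smul_tmul, smul_assoc, smul_eq_mul, ← TensorProduct.smul_tmul,
        h.tmul_mul]
      exact Ideal.mul_mem_left _ _ (hx (r • l))
    | add b c hb hc =>
      rw [add_smul, TensorProduct.tmul_add, map_add]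
      exact add_mem hb hc

end IsBaseChangeFamily

end BaseChange

section Tau

variable {Φ : (n : ℕ) → (RootMod A p e R n (LObj R L (p ^ e) n)
      →ₗ[BRing A p e R n] BRing A p e R n)} (I 𝔞 : Ideal R) (lam : ℝ)

theorem tauRel_eq_iSup (n : ℕ) :
    tauRel A p e R L Φ I 𝔞 lam n = ⨆ i : Fin (n + 1),
      (rootImage Φ i (𝔞 ^ ⌈((p : ℝ) ^ e) ^ (i : ℕ) * lam⌉₊ * I)).map
        (aMap A p e R i n (Nat.lt_succ_iff.mp i.isLt)) := by
  simp only [tauRel, rootImage, Ideal.map_span]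

variable {I 𝔞 lam}

theorem map_rootImage_le_tauRel {i n : ℕ} (h : i ≤ n) :
    (rootImage Φ i (𝔞 ^ ⌈((p : ℝ) ^ e) ^ i * lam⌉₊ * I)).map (aMap A p e R i n h) ≤
      tauRel A p e R L Φ I 𝔞 lam n := by
  rw [tauRel_eq_iSup]
  exact le_iSup (fun i : Fin (n + 1) =>
    (rootImage Φ i (𝔞 ^ ⌈((p : ℝ) ^ e) ^ (i : ℕ) * lam⌉₊ * I)).map
      (aMap A p e R i n (Nat.lt_succ_iff.mp i.isLt))) ⟨i, Nat.lt_succ_iff.mpr h⟩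

theorem rootImage_le_tauRel (n : ℕ) :
    rootImage Φ n (𝔞 ^ ⌈((p : ℝ) ^ e) ^ n * lam⌉₊ * I) ≤ tauRel A p e R L Φ I 𝔞 lam n :=
  (BRing.map_aMap_self n _).ge.trans (map_rootImage_le_tauRel le_rfl)

theorem tauRel_le {n : ℕ} {J : Ideal (BRing A p e R n)}
    (hJ : ∀ (i : ℕ) (h : i ≤ n), (rootImage Φ i (𝔞 ^ ⌈((p : ℝ) ^ e) ^ i * lam⌉₊ * I)).map
      (aMap A p e R i n h) ≤ J) : tauRel A p e R L Φ I 𝔞 lam n ≤ J := by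
  rw [tauRel_eq_iSup]
  exact iSup_le fun i => hJ i _

theorem tauRel_zero :
    tauRel A p e R L Φ I 𝔞 lam 0 = rootImage Φ 0 (𝔞 ^ ⌈((p : ℝ) ^ e) ^ 0 * lam⌉₊ * I) := by
  refine le_antisymm (tauRel_le fun i h => ?_) (rootImage_le_tauRel 0)
  obtain rfl := Nat.le_zero.mp h
  exact (BRing.map_aMap_self 0 _).le

theorem tauRel_succ (n : ℕ) :
    tauRel A p e R L Φ I 𝔞 lam (n + 1) =
      (tauRel A p e R L Φ I 𝔞 lam n).map (aMap A p e R n (n + 1) n.le_succ) ⊔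
        rootImage Φ (n + 1) (𝔞 ^ ⌈((p : ℝ) ^ e) ^ (n + 1) * lam⌉₊ * I) := by
  apply le_antisymm
  · refine tauRel_le fun i h => ?_
    obtain h' | rfl := Nat.le_succ_iff.mp h
    · rw [← BRing.map_aMap_map_aMap h' n.le_succ]
      exact le_sup_of_le_left (Ideal.map_mono (map_rootImage_le_tauRel h'))
    · exact le_sup_of_le_right (BRing.map_aMap_self _ _).le
  · refine sup_le (Ideal.map_le_iff_le_comap.mpr (tauRel_le fun i h => ?_)) (rootImage_le_tauRel _)
    rw [← Ideal.map_le_iff_le_comap, BRing.map_aMap_map_aMap]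
    exact map_rootImage_le_tauRel _

variable {Φt : (n : ℕ) → (L ⊗[R] BRing A p e R n) →+ BRing A p e R (n + 1)}
variable {φ : RootMod A p e R 1 L →ₗ[BRing A p e R 1] BRing A p e R 1}

/-- If the summands of the limiting test ideals satisfy the recursion
`K_{n+1} = φ̃_{n+1}((L ⊗ 𝔠 K_n)^{1/q})`, then stabilization at one step propagates to the next. -/
theorem map_tauRel_eq_succ_of_recursion (hφ : IsBaseChangeFamily Φt φ) (𝔠 : Ideal R)
    (hrec : ∀ n, rootImage Φ (n + 1) (𝔞 ^ ⌈((p : ℝ) ^ e) ^ (n + 1) * lam⌉₊ * I) =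
      shiftIdeal Φt n (𝔠.map (algebraMap R (BRing A p e R n)) *
        rootImage Φ n (𝔞 ^ ⌈((p : ℝ) ^ e) ^ n * lam⌉₊ * I)))
    {n : ℕ} (hstab : (tauRel A p e R L Φ I 𝔞 lam n).map (aMap A p e R n (n + 1) n.le_succ) =
      tauRel A p e R L Φ I 𝔞 lam (n + 1)) :
    (tauRel A p e R L Φ I 𝔞 lam (n + 1)).map (aMap A p e R (n + 1) (n + 2) (n + 1).le_succ) =
      tauRel A p e R L Φ I 𝔞 lam (n + 2) := by
  have hmap (m : ℕ) (J : Ideal (BRing A p e R m)) :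
      shiftIdeal Φt (m + 1) (𝔠.map (algebraMap R (BRing A p e R (m + 1))) *
          J.map (aMap A p e R m (m + 1) m.le_succ)) ≤
        (shiftIdeal Φt m (𝔠.map (algebraMap R (BRing A p e R m)) * J)).map
          (aMap A p e R (m + 1) (m + 2) (m + 1).le_succ) := by
    refine le_trans (le_of_eq ?_) (hφ.shiftIdeal_map_le m _)
    rw [Ideal.map_mul, BRing.map_algebraMap_aMap]
  have hle (m : ℕ) : shiftIdeal Φt m (𝔠.map (algebraMap R (BRing A p e R m)) *
      tauRel A p e R L Φ I 𝔞 lam m) ≤ tauRel A p e R L Φ I 𝔞 lam (m + 1) := by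
    induction m with
    | zero =>
      rw [tauRel_zero, ← hrec]
      exact rootImage_le_tauRel _
    | succ m ih =>
      rw [tauRel_succ (n := m), tauRel_succ (n := m + 1), Ideal.mul_sup]
      exact (shiftIdeal_sup_le _ _ _).trans (sup_le_sup
        ((hmap m _).trans (Ideal.map_mono ih)) (hrec (m + 1)).ge)
  rw [tauRel_succ (n := n + 1), left_eq_sup, hrec]
  calc _ ≤ shiftIdeal Φt (n + 1) (𝔠.map (algebraMap R (BRing A p e R (n + 1))) *
          tauRel A p e R L Φ I 𝔞 lam (n + 1)) :=
        shiftIdeal_mono _ (Ideal.mul_mono_right (rootImage_le_tauRel _))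
    _ ≤ _ := by
      rw [← hstab]
      exact (hmap n _).trans (Ideal.map_mono (hle n |>.trans hstab.ge))

end Tau

section Exponents

/-- The exponents `⌈q^n λ⌉` grow by `q^n (q - 1) λ`, and `λ` is large enough for
`𝔞^{⌈q^{n+1} λ⌉} = (𝔞^{(q - 1) λ})^{[q^n]} 𝔞^{⌈q^n λ⌉}`. -/
theorem pow_ceil_succ_eq_map_iterateFrobenius_mul {s : Finset R} (hs : s.Nonempty) {lam : ℝ}
    (hlam : 0 ≤ lam) (hcard : (s.card : ℝ) - 1 ≤ lam) {k : ℕ}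
    (hk : ((p : ℝ) ^ e - 1) * lam = k) (n : ℕ) :
    Ideal.span (s : Set R) ^ ⌈((p : ℝ) ^ e) ^ (n + 1) * lam⌉₊ =
      (Ideal.span (s : Set R) ^ k).map (iterateFrobenius R p (e * n)) *
        Ideal.span (s : Set R) ^ ⌈((p : ℝ) ^ e) ^ n * lam⌉₊ := by
  have hceil : ⌈((p : ℝ) ^ e) ^ (n + 1) * lam⌉₊ =
      ⌈((p : ℝ) ^ e) ^ n * lam⌉₊ + p ^ (e * n) * k := by
    rw [← Nat.ceil_add_natCast (by positivity)]
    congr 1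
    push_cast
    rw [← hk, pow_mul]
    ring
  have hN : s.card * p ^ (e * n) ≤ ⌈((p : ℝ) ^ e) ^ n * lam⌉₊ + p ^ (e * n) := by
    have hpos : (0 : ℝ) ≤ ((p : ℝ) ^ e) ^ n := by positivity
    have h := (mul_le_mul_of_nonneg_left hcard hpos).trans (Nat.le_ceil _)
    have : (s.card * p ^ (e * n) : ℝ) ≤ ⌈((p : ℝ) ^ e) ^ n * lam⌉₊ + p ^ (e * n) := by
      rw [pow_mul]
      linarith
    exact_mod_cast this
  rw [hceil]
  apply le_antisymm
  · rw [mul_comm (Ideal.map _ _)]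
    exact Ideal.span_pow_add_mul_le_mul_map_iterateFrobenius p hs hN k
  · rw [pow_add, mul_comm]
    refine Ideal.mul_mono_right (Ideal.map_le_iff_le_comap.mpr fun c hc => ?_)
    rw [Ideal.mem_comap, iterateFrobenius_def, mul_comm, pow_mul]
    exact Ideal.pow_mem_pow hc _

end Exponents

end Auxiliary

section Setting

/-! ### The Setting

`A` is a Noetherian integral domain of characteristic `p > 0`, `R` is an integral
domain which is flat and essentially of finite type over `A`, `q = p^e`,
`L` is an invertible `R`-module, `φ : L^{1/q} → B_1 = R ⊗_A A^{1/q}` is a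
`B_1`-module homomorphism, `I` and `𝔞` are nonzero ideals of `R` and `lam > 0` is
a real number.

The map `φ̃_{n+1} : (L ⊗_R B_n)^{1/q} → B_{n+1}` is the additive map `Φt n`
(uniquely) characterized by the hypothesis `hΦt`, and the `B_n`-linear map
`φ^n : (L^{(n)})^{1/q^n} → B_n` is the map `Φ n`, (uniquely) characterized by the
recursion hypotheses `hΦzero`, `hΦsucc`. -/

variable (A : Type u) [CommRing A] [IsDomain A] [IsNoetherianRing A]
variable (p : ℕ) [Fact p.Prime] [CharP A p] (e : ℕ)
variable (R : Type u) [CommRing R] [IsDomain R] [Algebra A R] [CharP R p]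
variable [Module.Flat A R] [Algebra.EssFiniteType A R]
variable (L : Type u) [AddCommGroup L] [Module R L]
variable [Module.Finite R L] [Module.Projective R L]
variable (I 𝔞 : Ideal R) (lam : ℝ)
variable (φ : RootMod A p e R 1 L →ₗ[BRing A p e R 1] BRing A p e R 1)
variable (Φt : (n : ℕ) → (L ⊗[R] BRing A p e R n) →+ BRing A p e R (n + 1))
variable (Φ : (n : ℕ) → (RootMod A p e R n (LObj R L (p ^ e) n)
  →ₗ[BRing A p e R n] BRing A p e R n))

/-- stabilization propagates.  In the Setting, assume that
`lam > μ(𝔞) - 1` (expressed by the existence of a generating set `s` of `𝔞` with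
`s.card - 1 < lam`) and that `(q-1)·lam` is an integer.  If
`τ_{n-1}(X/V, φ I, 𝔞^lam) B_n = τ_n(X/V, φ I, 𝔞^lam)` for some `n ≥ 1`, then
`τ_{m-1}(X/V, φ I, 𝔞^lam) B_m = τ_m(X/V, φ I, 𝔞^lam)` for every `m > n`. -/
theorem statement5
    (hp : p.Prime) (hI : I ≠ ⊥) (h𝔞 : 𝔞 ≠ ⊥) (hlam : 0 < lam)
    (hL : ∃ L' : ModuleCat.{u} R, Nonempty ((L ⊗[R] L') ≃ₗ[R] R))
    (hΦt : ∀ (n : ℕ) (l : L) (r : R) (a : ARoot A p e n),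
      Φt n (l ⊗ₜ[R] (r ⊗ₜ[A] a))
        = aMap A p e R 1 (n+1) (by omega) (φ (RootMod.of A p e R 1 (r • l)))
            * (show BRing A p e R (n+1) from (1 : R) ⊗ₜ[A] (ARoot.cast n (n+1) a)))
    (hΦzero : Φ 0 (RootMod.of A p e R 0 (1 : R)) = 1)
    (hΦsucc : ∀ (n : ℕ) (l : L) (w : LObj R L (p ^ e) n),
      Φ (n+1) (RootMod.of A p e R (n+1)
          ((PiTensorProduct.tprod R fun _ : Fin ((p ^ e) ^ n) => l) ⊗ₜ[R] w))
        = Φt n (l ⊗ₜ[R] (Φ n (RootMod.of A p e R n w))))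
    (s : Finset R) (hs : Ideal.span (s : Set R) = 𝔞)
    (hcard : (s.card : ℝ) - 1 < lam)
    (hint : ∃ k : ℤ, ((p : ℝ) ^ e - 1) * lam = (k : ℝ))
    (n : ℕ) (hn : 1 ≤ n)
    (hstab : Ideal.map (aMap A p e R (n - 1) n (Nat.sub_le n 1))
        (tauRel A p e R L Φ I 𝔞 lam (n - 1)) = tauRel A p e R L Φ I 𝔞 lam n) :
    ∀ m : ℕ, n < m →
      Ideal.map (aMap A p e R (m - 1) m (Nat.sub_le m 1))
        (tauRel A p e R L Φ I 𝔞 lam (m - 1)) = tauRel A p e R L Φ I 𝔞 lam m := by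
  have : Module.Invertible R L := by
    obtain ⟨L', ⟨f⟩⟩ := hL
    exact Module.Invertible.left f
  have hs0 : s.Nonempty := by
    rw [Finset.nonempty_iff_ne_empty]
    rintro rfl
    exact h𝔞 (by rw [← hs, Finset.coe_empty, Ideal.span_empty])
  obtain ⟨k, hk⟩ : ∃ k : ℕ, ((p : ℝ) ^ e - 1) * lam = k := by
    obtain ⟨k, hk⟩ := hint
    have hq : (1 : ℝ) ≤ (p : ℝ) ^ e := one_le_pow₀ (by exact_mod_cast hp.one_le)
    have hk0 : 0 ≤ k := by exact_mod_cast hk ▸ mul_nonneg (sub_nonneg.mpr hq) hlam.le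
    lift k to ℕ using hk0
    exact ⟨k, by exact_mod_cast hk⟩
  have hφ : IsBaseChangeFamily Φt φ := hΦt
  have hrec (n : ℕ) : rootImage Φ (n + 1) (𝔞 ^ ⌈((p : ℝ) ^ e) ^ (n + 1) * lam⌉₊ * I) =
      shiftIdeal Φt n ((𝔞 ^ k).map (algebraMap R (BRing A p e R n)) *
        rootImage Φ n (𝔞 ^ ⌈((p : ℝ) ^ e) ^ n * lam⌉₊ * I)) := by
    rw [rootImage_succ hΦsucc, map_mul_rootImage, ← mul_assoc, ← hs,
      pow_ceil_succ_eq_map_iterateFrobenius_mul hs0 hlam.le hcard.le hk]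
  obtain ⟨n, rfl⟩ := Nat.exists_eq_add_of_le' hn
  intro m hm
  induction m, hm using Nat.le_induction with
  | base => exact map_tauRel_eq_succ_of_recursion hφ (𝔞 ^ k) hrec hstab
  | succ m hm ih =>
    obtain ⟨m, rfl⟩ := Nat.exists_eq_add_of_le' (show 1 ≤ m by omega)
    exact map_tauRel_eq_succ_of_recursion hφ (𝔞 ^ k) hrec ih

end Setting
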